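/- For all 0 < ε ≤ 1, Δ(ε) ≤ π ε² / (1 + √(1 − ε))². -/

import Mathlib

open MeasureTheory

/-- A set `C ⊆ ℝ` is symmetric if there is a center `c` with `c + x ∈ C ↔ c - x ∈ C`. -/
def IsSymmetricSet (C : Set ℝ) : Prop := ∃ c : ℝ, ∀ x : ℝ, c + x ∈ C ↔ c - x ∈ C

/-- `DD A` is the supremum of measures of measurable symmetric subsets of `A`. -/
noncomputable def DD (A : Set ℝ) : ℝ :=
  sSup {m : ℝ | ∃ C : Set ℝ, C ⊆ A ∧ MeasurableSet C ∧ IsSymmetricSet C ∧ m = (volume C).toReal}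

/-- `Δ ε` is the infimum of `DD A` over measurable `A ⊆ [0,1)` with measure `ε`. -/
noncomputable def Δ (ε : ℝ) : ℝ :=
  sInf {d : ℝ | ∃ A : Set ℝ, A ⊆ Set.Ico (0:ℝ) 1 ∧ MeasurableSet A ∧
    volume A = ENNReal.ofReal ε ∧ d = DD A}

open Finset Function

/-- A function of real variables `x 0, x 1, …` is affine in each variable separately. -/
def IsMultiAffine (F : (ℕ → ℝ) → ℝ) : Prop :=
  ∀ x i t, F (update x i t) = (1 - t) * F (update x i 0) + t * F (update x i 1)

namespace IsMultiAffine

lemma add {F G : (ℕ → ℝ) → ℝ} (hF : IsMultiAffine F) (hG : IsMultiAffine G) :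
    IsMultiAffine fun x => F x + G x := by
  intro x i t
  simp only [hF x i t, hG x i t]
  ring

lemma const_mul {F : (ℕ → ℝ) → ℝ} (hF : IsMultiAffine F) (c : ℝ) :
    IsMultiAffine fun x => c * F x := by
  intro x i t
  simp only [hF x i t]
  ring

lemma sum {ι : Type*} (s : Finset ι) {F : ι → (ℕ → ℝ) → ℝ} (hF : ∀ a, IsMultiAffine (F a)) :
    IsMultiAffine fun x => ∑ a ∈ s, F a x := by
  intro x i t
  simp only [mul_sum, ← sum_add_distrib]
  exact sum_congr rfl fun a _ => hF a x i t

lemma prod {s : Finset ℕ} {g : ℕ → (ℕ → ℝ) → ℝ} (hg : ∀ a ∈ s, IsMultiAffine (g a))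
    (m : ℕ → ℕ) (h : ∀ i, ∀ a ∈ s, a ≠ m i → ∀ x t, g a (update x i t) = g a x) :
    IsMultiAffine fun x => ∏ a ∈ s, g a x := by
  intro x i t
  by_cases hm : m i ∈ s
  · have key : ∀ t, ∏ a ∈ s, g a (update x i t)
        = g (m i) (update x i t) * ∏ a ∈ s.erase (m i), g a x := fun t => by
      rw [← mul_prod_erase s _ hm]
      congr 1
      exact prod_congr rfl fun a ha => h i a (mem_of_mem_erase ha) (ne_of_mem_erase ha) x t
    simp only [key]
    rw [hg _ hm x i t]
    ring
  · have key : ∀ t, ∏ a ∈ s, g a (update x i t) = ∏ a ∈ s, g a x := fun t =>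
      prod_congr rfl fun a ha => h i a ha (fun h' => hm (h' ▸ ha)) x t
    simp only [key]
    ring

/-- A multi-affine function on a cube is bounded below by its value at some vertex. -/
lemma exists_vertex_le {F : (ℕ → ℝ) → ℝ} (hF : IsMultiAffine F) {p : ℕ → ℝ}
    (hp : ∀ i, p i ∈ Set.Icc (0 : ℝ) 1) (s : Finset ℕ) :
    ∃ x : ℕ → ℝ, (∀ i ∈ s, x i = 0 ∨ x i = 1) ∧ (∀ i ∉ s, x i = p i) ∧ F x ≤ F p := by
  induction s using Finset.induction_on with
  | empty => exact ⟨p, by simp, by simp, le_rfl⟩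
  | insert a s ha ih =>
    obtain ⟨x, hx, hxp, hle⟩ := ih
    have hself := hF x a (x a)
    rw [update_eq_self] at hself
    have h01 := hp a
    rw [← hxp a ha] at h01
    have hv : ∃ v : ℝ, (v = 0 ∨ v = 1) ∧ F (update x a v) ≤ F x := by
      rcases le_total (F (update x a 0)) (F (update x a 1)) with h | h
      · exact ⟨0, .inl rfl, by nlinarith [h01.1]⟩
      · exact ⟨1, .inr rfl, by nlinarith [h01.2]⟩
    obtain ⟨v, hv, hvle⟩ := hv
    refine ⟨update x a v, fun i hi => ?_, fun i hi => ?_, hvle.trans hle⟩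
    · by_cases hia : i = a
      · subst hia; simpa using hv
      · rw [update_of_ne hia]
        exact hx i ((mem_insert.1 hi).resolve_left hia)
    · rw [mem_insert, not_or] at hi
      rw [update_of_ne hi.1]
      exact hxp i hi.2

end IsMultiAffine

lemma prod_one_add_exp_sub_one_mul_le {s : Finset ℕ} {y : ℕ → ℝ} {u : ℝ} (hu : |u| ≤ 1)
    (hy : ∀ i ∈ s, y i ∈ Set.Icc (0 : ℝ) 1) :
    ∏ i ∈ s, (1 + (Real.exp u - 1) * y i) ≤ Real.exp ((u + u ^ 2) * ∑ i ∈ s, y i) := by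
  rw [mul_sum, Real.exp_sum]
  refine prod_le_prod (fun i hi => ?_) fun i hi => ?_
  · nlinarith [(hy i hi).1, (hy i hi).2, Real.exp_pos u]
  · have h1 := (abs_le.1 (Real.abs_exp_sub_one_sub_id_le hu)).2
    have h2 := Real.add_one_le_exp ((u + u ^ 2) * y i)
    nlinarith [(hy i hi).1]

lemma prod_one_add_exp_sub_one_mul_eq {s : Finset ℕ} {y : ℕ → ℝ} (u : ℝ)
    (hy : ∀ i ∈ s, y i = 0 ∨ y i = 1) :
    ∏ i ∈ s, (1 + (Real.exp u - 1) * y i) = Real.exp (u * ∑ i ∈ s, y i) := by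
  rw [mul_sum, Real.exp_sum]
  refine prod_congr rfl fun i hi => ?_
  rcases hy i hi with h | h <;> simp [h]

/-- The normalized central binomial coefficients `4⁻ⁿ * (2n choose n)`. -/
noncomputable def centralWeight (n : ℕ) : ℝ := ∏ i ∈ range n, ((2 * i + 1) / (2 * i + 2) : ℝ)

lemma centralWeight_succ (n : ℕ) :
    (n + 1) * centralWeight (n + 1) = (n + 1 / 2) * centralWeight n := by
  rw [centralWeight, prod_range_succ, ← centralWeight]
  field_simp

lemma centralWeight_pos (n : ℕ) : 0 < centralWeight n := prod_pos fun i _ => by positivity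

lemma sum_antidiagonal_centralWeight (n : ℕ) :
    ∑ q ∈ antidiagonal n, centralWeight q.1 * centralWeight q.2 = 1 := by
  have sym : ∀ m : ℕ, 2 * ∑ q ∈ antidiagonal m, q.1 * (centralWeight q.1 * centralWeight q.2)
      = m * ∑ q ∈ antidiagonal m, centralWeight q.1 * centralWeight q.2 := fun m => by
    have h := Nat.sum_antidiagonal_swap (n := m)
      (f := fun q : ℕ × ℕ => (q.1 : ℝ) * (centralWeight q.1 * centralWeight q.2))
    rw [two_mul]
    nth_rw 1 [← h]
    rw [← sum_add_distrib, mul_sum]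
    refine sum_congr rfl fun q hq => ?_
    rw [← mem_antidiagonal.1 hq]
    simp only [Prod.fst_swap, Prod.snd_swap]
    push_cast
    ring
  induction n with
  | zero => simp [centralWeight]
  | succ n ih =>
    have h1 := sym (n + 1)
    rw [Nat.sum_antidiagonal_succ] at h1
    simp only [Nat.cast_zero, zero_mul, zero_add] at h1
    have h2 : ∑ q ∈ antidiagonal n,
        ((q.1 + 1 : ℕ) : ℝ) * (centralWeight (q.1 + 1) * centralWeight q.2)
        = ∑ q ∈ antidiagonal n, (q.1 * (centralWeight q.1 * centralWeight q.2)
          + 1 / 2 * (centralWeight q.1 * centralWeight q.2)) := by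
      refine sum_congr rfl fun q _ => ?_
      push_cast
      rw [← mul_assoc, centralWeight_succ]
      ring
    have h3 := sym n
    rw [h2, sum_add_distrib, ← mul_sum, ih] at h1
    rw [ih] at h3
    push_cast at h1
    have : ((n : ℝ) + 1) * (∑ q ∈ antidiagonal (n + 1), centralWeight q.1 * centralWeight q.2 - 1)
        = 0 := by linarith
    rcases mul_eq_zero.1 this with h | h
    · exact absurd h (by positivity)
    · linarith

lemma one_le_pi_mul_centralWeight_sq (n : ℕ) :
    1 ≤ Real.pi * (n + 1 / 2) * centralWeight n ^ 2 := by
  have h : centralWeight n ^ 2 * (2 * n + 1) * Real.Wallis.W n = 1 := by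
    induction n with
    | zero => simp [centralWeight, Real.Wallis.W]
    | succ n ih =>
      rw [Real.Wallis.W_succ, centralWeight, prod_range_succ, ← centralWeight]
      refine Eq.trans ?_ ih
      push_cast
      field_simp
      ring
  have := mul_le_mul_of_nonneg_left (Real.Wallis.W_le n)
    (by positivity : 0 ≤ centralWeight n ^ 2 * (2 * n + 1))
  nlinarith

lemma le_sum_min_one_div_sqrt {c : ℝ} (hc : 0 ≤ c) (n : ℕ) :
    2 * c * √(n + 1) - c ^ 2 - 1 ≤ ∑ i ∈ range n, min 1 (c / √(i + 1)) := by
  have amgm : ∀ m : ℕ, 2 * c * √(m + 1) - c ^ 2 - 1 ≤ m := fun m => by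
    nlinarith [sq_nonneg (c - √(m + 1)), Real.sq_sqrt (by positivity : (0 : ℝ) ≤ m + 1)]
  induction n with
  | zero => simpa using amgm 0
  | succ n ih =>
    rcases le_total c √(n + 1) with h | h
    · have hpos : 0 < √((n : ℝ) + 1) := by positivity
      rw [sum_range_succ, min_eq_right ((div_le_one hpos).2 h)]
      have h1 : 2 * c * √((n + 1 : ℕ) + 1) ≤ 2 * c * √(n + 1) + c / √(n + 1) := by
        have e1 := Real.sq_sqrt (by positivity : (0 : ℝ) ≤ n + 1)
        have e2 := Real.sq_sqrt (by positivity : (0 : ℝ) ≤ (n + 1 : ℕ) + 1)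
        push_cast at e2 ⊢
        rw [show 2 * c * √((n : ℝ) + 1) + c / √(n + 1)
          = c * (2 * √(n + 1) ^ 2 + 1) / √(n + 1) by field_simp, le_div_iff₀ hpos]
        have : 2 * (√((n : ℝ) + 1 + 1) * √(n + 1)) ≤ 2 * √((n : ℝ) + 1) ^ 2 + 1 := by
          nlinarith [sq_nonneg (√((n : ℝ) + 1 + 1) - √(n + 1))]
        nlinarith
      linarith
    · have : ∑ i ∈ range (n + 1), min 1 (c / √(i + 1)) = (n + 1 : ℕ) := by
        rw [sum_congr rfl (g := fun _ => (1 : ℝ)), sum_const, card_range, nsmul_eq_mul, mul_one]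
        intro i hi
        refine min_eq_left ((one_le_div (by positivity)).2 (le_trans ?_ h))
        have : i ≤ n := by have := mem_range.1 hi; omega
        gcongr
      rw [this]
      exact amgm _

/-- The smaller entries of the off-diagonal pairs of natural numbers with sum `k`. -/
def lowerHalf (k : ℕ) : Finset ℕ := {i ∈ range (k + 1) | 2 * i < k}

lemma sum_antidiagonal_mul_eq_two_mul_add {y : ℕ → ℝ} (hy : ∀ i, y i ∈ Set.Icc (0 : ℝ) 1)
    (k : ℕ) : ∃ e ∈ Set.Icc (0 : ℝ) 1, ∑ q ∈ antidiagonal k, y q.1 * y q.2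
      = 2 * ∑ i ∈ lowerHalf k, y i * y (k - i) + e := by
  have hmul : ∀ i j, y i * y j ∈ Set.Icc (0 : ℝ) 1 := fun i j =>
    ⟨mul_nonneg (hy i).1 (hy j).1, mul_le_one₀ (hy i).2 (hy j).1 (hy j).2⟩
  have hupper : ∑ i ∈ range (k + 1) with ¬ 2 * i < k ∧ ¬ 2 * i = k, y i * y (k - i)
      = ∑ i ∈ lowerHalf k, y i * y (k - i) := by
    refine sum_nbij' (fun i => k - i) (fun i => k - i) ?_ ?_ ?_ ?_ ?_
    · intro i hi
      simp only [lowerHalf, mem_filter, mem_range] at hi ⊢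
      omega
    · intro i hi
      simp only [lowerHalf, mem_filter, mem_range] at hi ⊢
      omega
    · intro i hi
      simp only [mem_filter, mem_range] at hi
      omega
    · intro i hi
      simp only [lowerHalf, mem_filter, mem_range] at hi
      omega
    · intro i hi
      simp only [mem_filter, mem_range] at hi
      rw [show k - (k - i) = i by omega, mul_comm]
  refine ⟨∑ i ∈ range (k + 1) with ¬ 2 * i < k ∧ 2 * i = k, y i * y (k - i),
    ⟨sum_nonneg fun i _ => (hmul _ _).1, ?_⟩, ?_⟩
  · refine (sum_le_card_nsmul _ _ 1 fun i _ => (hmul _ _).2).trans ?_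
    rw [nsmul_eq_mul, mul_one]
    refine mod_cast card_le_one.2 fun a ha b hb => ?_
    simp only [mem_filter] at ha hb
    omega
  · rw [Nat.sum_antidiagonal_eq_sum_range_succ fun i j => y i * y j,
      ← sum_filter_add_sum_filter_not _ (fun i => 2 * i < k),
      ← sum_filter_add_sum_filter_not (filter (fun i => ¬ 2 * i < k) _) (fun i => 2 * i = k),
      filter_filter, filter_filter, hupper, lowerHalf]
    ring

lemma isMultiAffine_prod_lowerHalf (c : ℝ) (k : ℕ) :
    IsMultiAffine fun x => ∏ i ∈ lowerHalf k, (1 + c * (x i * x (k - i))) := by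
  refine IsMultiAffine.prod (g := fun i x => 1 + c * (x i * x (k - i))) (fun a ha x i t => ?_)
    (fun i => min i (k - i)) fun i a ha hai x t => ?_
  · simp only [lowerHalf, mem_filter, mem_range] at ha
    have hne : a ≠ k - a := by omega
    by_cases h1 : a = i
    · subst h1
      simp only [update_self, update_of_ne hne.symm]
      ring
    · by_cases h2 : k - a = i
      · simp only [h2, update_self, update_of_ne h1]
        ring
      · simp only [update_of_ne h1, update_of_ne h2]
        ring
  · simp only [lowerHalf, mem_filter, mem_range] at ha
    have h1 : a ≠ i := by omega
    have h2 : k - a ≠ i := by omega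
    simp only [update_of_ne h1, update_of_ne h2]

lemma isMultiAffine_prod_one_add_mul (c : ℝ) (s : Finset ℕ) :
    IsMultiAffine fun x => ∏ i ∈ s, (1 + c * x i) := by
  refine IsMultiAffine.prod (g := fun i x => 1 + c * x i) (fun a _ x i t => ?_) id
    fun i a _ hai x t => ?_
  · by_cases h : a = i
    · subst h
      simp only [update_self]
      ring
    · simp only [update_of_ne h]
      ring
  · simp only [update_of_ne (show a ≠ i from hai)]

/-- Weights in `[0, 1]` can be rounded to `0` or `1` so that the total hardly drops and the
additive self-convolution hardly grows. -/
lemma exists_zero_one_approx {δ : ℝ} (hδ : 0 < δ) (hδ1 : δ ≤ 1) {N : ℕ}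
    (hN : (2 * N + 1) * Real.exp (-(δ ^ 2 / 4 * N)) < 1) {p : ℕ → ℝ}
    (hp : ∀ i, p i ∈ Set.Icc (0 : ℝ) 1) (hp0 : ∀ i, N ≤ i → p i = 0) :
    ∃ x : ℕ → ℝ, (∀ i, x i = 0 ∨ x i = 1) ∧ (∀ i, N ≤ i → x i = 0) ∧
      ∑ i ∈ range N, p i - δ * N ≤ ∑ i ∈ range N, x i ∧
      ∀ k, ∑ q ∈ antidiagonal k, x q.1 * x q.2
        ≤ ∑ q ∈ antidiagonal k, p q.1 * p q.2 + 2 * δ * N + 1 := by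
  set u := δ / 2 with hu
  set μ : ℕ → ℝ := fun k => ∑ i ∈ lowerHalf k, p i * p (k - i) with hμ
  set M := ∑ i ∈ range N, p i with hM
  set F : (ℕ → ℝ) → ℝ := fun x =>
    ∑ k ∈ range (2 * N), Real.exp (-u * (μ k + δ * N)) *
        ∏ i ∈ lowerHalf k, (1 + (Real.exp u - 1) * (x i * x (k - i)))
      + Real.exp (u * (M - δ * N)) * ∏ i ∈ range N, (1 + (Real.exp (-u) - 1) * x i) with hF
  have hFaff : IsMultiAffine F :=
    (IsMultiAffine.sum _ fun k => (isMultiAffine_prod_lowerHalf _ k).const_mul _).add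
      ((isMultiAffine_prod_one_add_mul _ _).const_mul _)
  have hmul : ∀ i j, p i * p j ∈ Set.Icc (0 : ℝ) 1 := fun i j =>
    ⟨mul_nonneg (hp i).1 (hp j).1, mul_le_one₀ (hp i).2 (hp j).1 (hp j).2⟩
  have hMN : M ≤ N := by
    simpa using sum_le_card_nsmul (range N) p 1 fun i _ => (hp i).2
  have hμN : ∀ k ∈ range (2 * N), μ k ≤ N := fun k hk => by
    have hsub : lowerHalf k ⊆ range N := fun i hi => by
      simp only [lowerHalf, mem_filter, mem_range] at hi hk ⊢
      omega
    calc μ k ≤ ∑ i ∈ range N, p i * p (k - i) :=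
          sum_le_sum_of_subset_of_nonneg hsub fun i _ _ => (hmul _ _).1
      _ ≤ N := by simpa using sum_le_card_nsmul (range N) _ 1 fun i _ => (hmul i (k - i)).2
  have hFp : F p < 1 := by
    refine lt_of_le_of_lt ?_ hN
    have h1 : ∀ k ∈ range (2 * N), Real.exp (-u * (μ k + δ * N)) *
        ∏ i ∈ lowerHalf k, (1 + (Real.exp u - 1) * (p i * p (k - i)))
        ≤ Real.exp (-(δ ^ 2 / 4 * N)) := fun k hk => by
      refine (mul_le_mul_of_nonneg_left (prod_one_add_exp_sub_one_mul_le
        (abs_le.2 ⟨by linarith, by linarith⟩) fun i _ => hmul _ _) (Real.exp_pos _).le).trans ?_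
      rw [← Real.exp_add, Real.exp_le_exp]
      have := mul_le_mul_of_nonneg_left (hμN k hk) (sq_nonneg u)
      simp only [hμ] at this ⊢
      rw [hu] at this ⊢
      nlinarith
    have h2 : Real.exp (u * (M - δ * N)) * ∏ i ∈ range N, (1 + (Real.exp (-u) - 1) * p i)
        ≤ Real.exp (-(δ ^ 2 / 4 * N)) := by
      refine (mul_le_mul_of_nonneg_left (prod_one_add_exp_sub_one_mul_le
        (abs_le.2 ⟨by linarith, by linarith⟩) fun i _ => hp _) (Real.exp_pos _).le).trans ?_
      rw [← Real.exp_add, Real.exp_le_exp]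
      have := mul_le_mul_of_nonneg_left hMN (sq_nonneg u)
      rw [← hM]
      rw [hu] at this ⊢
      nlinarith
    have h3 := sum_le_card_nsmul _ _ _ h1
    rw [card_range, nsmul_eq_mul] at h3
    push_cast at h3
    simp only [hF]
    linarith
  obtain ⟨x, hx, hxp, hle⟩ := hFaff.exists_vertex_le hp (range N)
  have hx0 : ∀ i, N ≤ i → x i = 0 := fun i hi => by
    rw [hxp i (by simpa using hi), hp0 i hi]
  have hx01 : ∀ i, x i = 0 ∨ x i = 1 := fun i => by
    by_cases h : i < N
    · exact hx i (mem_range.2 h)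
    · exact .inl (hx0 i (not_lt.1 h))
  have hxmul : ∀ i j, x i * x j = 0 ∨ x i * x j = 1 := fun i j => by
    rcases hx01 i with h | h <;> rcases hx01 j with h' | h' <;> simp [h, h']
  have hxI : ∀ i, x i ∈ Set.Icc (0 : ℝ) 1 := fun i => by
    rcases hx01 i with h | h <;> simp [h]
  have hFx : ∑ k ∈ range (2 * N), Real.exp (u * (∑ i ∈ lowerHalf k, x i * x (k - i)
      - μ k - δ * N)) + Real.exp (u * (M - δ * N - ∑ i ∈ range N, x i)) < 1 := by
    refine lt_of_eq_of_lt ?_ (hle.trans_lt hFp)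
    simp only [hF]
    congr 1
    · refine sum_congr rfl fun k _ => ?_
      rw [prod_one_add_exp_sub_one_mul_eq _ fun i _ => hxmul _ _, ← Real.exp_add]
      ring_nf
    · rw [prod_one_add_exp_sub_one_mul_eq _ fun i _ => hx01 _, ← Real.exp_add]
      ring_nf
  have hu0 : 0 < u := by positivity
  have neg_of : ∀ a : ℝ, Real.exp (u * a) < 1 → a ≤ 0 := fun a ha =>
    (neg_of_mul_neg_right (Real.exp_lt_one_iff.1 ha) hu0.le).le
  refine ⟨x, hx01, hx0, ?_, fun k => ?_⟩
  · have := neg_of _ (lt_of_le_of_lt (le_add_of_nonneg_left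
      (sum_nonneg fun k _ => (Real.exp_pos _).le)) hFx)
    linarith
  · by_cases hk : k ∈ range (2 * N)
    · have h1 := single_le_sum (f := fun k => Real.exp (u * (∑ i ∈ lowerHalf k, x i * x (k - i)
        - μ k - δ * N))) (fun k _ => (Real.exp_pos _).le) hk
      have h2 := neg_of _ (lt_of_le_of_lt (h1.trans
        (le_add_of_nonneg_right (Real.exp_pos _).le)) hFx)
      obtain ⟨e, he, hxe⟩ := sum_antidiagonal_mul_eq_two_mul_add hxI k
      obtain ⟨e', he', hpe⟩ := sum_antidiagonal_mul_eq_two_mul_add hp k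
      rw [hxe, hpe]
      simp only [hμ] at h2
      linarith [he.2, he'.1]
    · have h0 : ∑ q ∈ antidiagonal k, x q.1 * x q.2 = 0 := sum_eq_zero fun q hq => by
        rw [HasAntidiagonal.mem_antidiagonal] at hq
        rw [mem_range] at hk
        rcases le_total N q.1 with h | h
        · rw [hx0 _ h, zero_mul]
        · rw [hx0 q.2 (by omega), mul_zero]
      rw [h0]
      have := sum_nonneg fun q (_ : q ∈ antidiagonal k) => (hmul q.1 q.2).1
      positivity

/-- The union of the cells `[i / N, (i + 1) / N)` with `i ∈ S`. -/
def stepSet (N : ℕ) (S : Finset ℕ) : Set ℝ :=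
  ⋃ i ∈ S, Set.Ico ((i : ℝ) / N) ((i + 1) / N)

lemma measurableSet_stepSet (N : ℕ) (S : Finset ℕ) : MeasurableSet (stepSet N S) :=
  S.measurableSet_biUnion fun _ _ => measurableSet_Ico

lemma mem_stepSet {N : ℕ} (hN : 0 < N) {S : Finset ℕ} {t : ℝ} :
    t ∈ stepSet N S ↔ ∃ i ∈ S, (i : ℝ) ≤ t * N ∧ t * N < i + 1 := by
  have : (0 : ℝ) < N := mod_cast hN
  simp only [stepSet, Set.mem_iUnion, Set.mem_Ico, div_le_iff₀ this, lt_div_iff₀ this,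
    exists_prop]

lemma volume_real_stepSet {N : ℕ} (hN : 0 < N) (S : Finset ℕ) :
    volume.real (stepSet N S) = #S / N := by
  have hN' : (0 : ℝ) < N := mod_cast hN
  rw [stepSet, measureReal_biUnion_finset _ (fun _ _ => measurableSet_Ico)
    fun _ _ => measure_Ico_lt_top.ne]
  · rw [sum_congr rfl (g := fun _ => 1 / (N : ℝ)), sum_const, nsmul_eq_mul]
    · ring
    · intro i _
      rw [Real.volume_real_Ico_of_le (by gcongr; linarith)]
      ring
  · intro i _ j _ hij
    rw [onFun, Set.disjoint_left]
    intro t hi hj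
    rw [Set.mem_Ico, div_le_iff₀ hN', lt_div_iff₀ hN'] at hi hj
    have h1 : (i : ℝ) < j + 1 := hi.1.trans_lt hj.2
    have h2 : (j : ℝ) < i + 1 := hj.1.trans_lt hi.2
    norm_cast at h1 h2
    omega

lemma stepSet_subset_Ico {N : ℕ} (hN : 0 < N) {S : Finset ℕ} (hS : S ⊆ range N) :
    stepSet N S ⊆ Set.Ico 0 1 := by
  intro t ht
  obtain ⟨i, hi, h1, h2⟩ := (mem_stepSet hN).1 ht
  have hN' : (0 : ℝ) < N := mod_cast hN
  have hiN : (i : ℝ) + 1 ≤ N := mod_cast mem_range.1 (hS hi)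
  constructor
  · exact nonneg_of_mul_nonneg_left ((Nat.cast_nonneg i).trans h1) hN'
  · by_contra! h
    nlinarith

/-- The overlap of a step set with its reflections is controlled by its numbers of pairs of
cells with a given sum of indices. -/
lemma volume_real_stepSet_inter_reflection_le {N : ℕ} (hN : 0 < N) {S : Finset ℕ} {B : ℝ}
    (hB : ∀ k, (#{q ∈ S ×ˢ S | q.1 + q.2 = k} : ℝ) ≤ B * N) (t : ℝ) :
    volume.real (stepSet N S ∩ {x | t - x ∈ stepSet N S}) ≤ B := by
  have hN' : (0 : ℝ) < N := mod_cast hN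
  have hB0 : 0 ≤ B := nonneg_of_mul_nonneg_left ((Nat.cast_nonneg _).trans (hB 0)) hN'
  set m := ⌊t * N⌋₊ with hm
  set θ := t * N - m with hθ
  set T : Finset (ℕ × ℕ) := {q ∈ S ×ˢ S | q.1 + q.2 = m} with hT
  set T' : Finset (ℕ × ℕ) := {q ∈ S ×ˢ S | q.1 + q.2 + 1 = m} with hT'
  rcases lt_or_ge (t * N) 0 with ht | ht
  · have : stepSet N S ∩ {x | t - x ∈ stepSet N S} = ∅ := by
      refine Set.eq_empty_of_forall_notMem fun x ⟨h1, h2⟩ => ?_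
      obtain ⟨i, -, hi, -⟩ := (mem_stepSet hN).1 h1
      obtain ⟨j, -, hj, -⟩ := (mem_stepSet hN).1 h2
      have := Nat.cast_nonneg (α := ℝ) i
      have := Nat.cast_nonneg (α := ℝ) j
      linarith
    rw [this]
    simpa using hB0
  · have hθ0 : 0 ≤ θ := sub_nonneg.2 (Nat.floor_le ht)
    have hθ1 : θ < 1 := by linarith [Nat.lt_floor_add_one (t * N)]
    have hsub : stepSet N S ∩ {x | t - x ∈ stepSet N S} ⊆
        (⋃ q ∈ T, Set.Icc ((q.1 : ℝ) / N) ((q.1 + θ) / N)) ∪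
          ⋃ q ∈ T', Set.Icc (((q.1 : ℝ) + θ) / N) ((q.1 + 1) / N) := by
      rintro x ⟨h1, h2⟩
      obtain ⟨i, hiS, hi, hi'⟩ := (mem_stepSet hN).1 h1
      obtain ⟨j, hjS, hj, hj'⟩ := (mem_stepSet hN).1 h2
      rw [sub_mul] at hj hj'
      have hle : i + j ≤ m := Nat.le_floor (by push_cast; linarith)
      have hlt : m < i + j + 2 := (Nat.floor_lt ht).2 (by push_cast; linarith)
      simp only [Set.mem_union, Set.mem_iUnion, Set.mem_Icc, div_le_iff₀ hN', le_div_iff₀ hN',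
        hT, hT', mem_filter, mem_product, exists_prop]
      rcases (by omega : i + j = m ∨ i + j + 1 = m) with h | h
      · have hc : (i : ℝ) + j = m := mod_cast h
        exact .inl ⟨(i, j), ⟨⟨hiS, hjS⟩, h⟩, hi, by linarith⟩
      · have hc : (i : ℝ) + j + 1 = m := mod_cast h
        exact .inr ⟨(i, j), ⟨⟨hiS, hjS⟩, h⟩, by linarith, hi'.le⟩
    have hcardT' : (#T' : ℝ) ≤ B * N := by
      rcases Nat.eq_zero_or_pos m with h | h
      · rw [hT', filter_false_of_mem fun q _ => by omega]
        simpa using by positivity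
      · rw [hT', filter_congr (q := fun q => q.1 + q.2 = m - 1) fun q _ => by omega]
        exact hB _
    have hfin : volume ((⋃ q ∈ T, Set.Icc ((q.1 : ℝ) / N) ((q.1 + θ) / N)) ∪
          ⋃ q ∈ T', Set.Icc (((q.1 : ℝ) + θ) / N) ((q.1 + 1) / N)) ≠ ⊤ :=
      (((T.isCompact_biUnion fun _ _ => isCompact_Icc).union
        (T'.isCompact_biUnion fun _ _ => isCompact_Icc)).measure_lt_top).ne
    have hV : volume.real (⋃ q ∈ T, Set.Icc ((q.1 : ℝ) / N) ((q.1 + θ) / N))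
        ≤ #T * (θ / N) := by
      refine (measureReal_biUnion_finset_le _ _).trans ?_
      rw [← nsmul_eq_mul]
      refine sum_le_card_nsmul _ _ _ fun q _ => ?_
      rw [Real.volume_real_Icc_of_le (by gcongr; linarith)]
      exact le_of_eq (by ring)
    have hV' : volume.real (⋃ q ∈ T', Set.Icc (((q.1 : ℝ) + θ) / N) ((q.1 + 1) / N))
        ≤ #T' * ((1 - θ) / N) := by
      refine (measureReal_biUnion_finset_le _ _).trans ?_
      rw [← nsmul_eq_mul]
      refine sum_le_card_nsmul _ _ _ fun q _ => ?_
      rw [Real.volume_real_Icc_of_le (by gcongr)]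
      exact le_of_eq (by ring)
    calc volume.real (stepSet N S ∩ {x | t - x ∈ stepSet N S})
        ≤ _ := measureReal_mono hsub hfin
      _ ≤ _ := measureReal_union_le _ _
      _ ≤ #T * (θ / N) + #T' * ((1 - θ) / N) := add_le_add hV hV'
      _ ≤ B * N * (θ / N) + B * N * ((1 - θ) / N) := by
        have : 0 ≤ 1 - θ := by linarith
        have := hB m
        gcongr
      _ = B := by field_simp; ring

lemma exists_measurable_subset_volume_eq {A : Set ℝ} (hA : A ⊆ Set.Ico 0 1)
    (hm : MeasurableSet A) {ε : ℝ} (hε : 0 ≤ ε) (hle : ε ≤ volume.real A) :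
    ∃ B ⊆ A, MeasurableSet B ∧ volume B = ENNReal.ofReal ε := by
  have hfin : ∀ C ⊆ A, volume C ≠ ⊤ := fun C hC =>
    ((measure_mono (hC.trans hA)).trans_lt measure_Ico_lt_top).ne
  have hlip : LipschitzWith 1 fun s => volume.real (A ∩ Set.Iio s) := by
    refine LipschitzWith.of_le_add fun s t => ?_
    have hsub : A ∩ Set.Iio s ⊆ (A ∩ Set.Iio t) ∪ Set.Icc t s := fun x hx => by
      rcases lt_or_ge x t with h | h
      · exact .inl ⟨hx.1, h⟩
      · exact .inr ⟨h, hx.2.le⟩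
    refine (measureReal_mono hsub (measure_union_ne_top (hfin _ Set.inter_subset_left)
      measure_Icc_lt_top.ne)).trans ((measureReal_union_le _ _).trans ?_)
    rw [Real.volume_real_Icc, Real.dist_eq]
    gcongr
    exact max_le (le_abs_self _) (abs_nonneg _)
  have h0 : A ∩ Set.Iio 0 = ∅ :=
    Set.eq_empty_of_forall_notMem fun x hx => (hA hx.1).1.not_gt hx.2
  have h1 : A ∩ Set.Iio 1 = A := Set.inter_eq_left.2 fun x hx => (hA hx).2
  obtain ⟨s, -, hs⟩ := intermediate_value_Icc zero_le_one hlip.continuous.continuousOn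
    (show ε ∈ Set.Icc (volume.real (A ∩ Set.Iio 0)) (volume.real (A ∩ Set.Iio 1)) by
      rw [h0, h1, measureReal_empty]; exact ⟨hε, hle⟩)
  refine ⟨A ∩ Set.Iio s, Set.inter_subset_left, hm.inter measurableSet_Iio, ?_⟩
  rw [← hs, ofReal_measureReal (hfin _ Set.inter_subset_left)]

lemma DD_nonneg (A : Set ℝ) : 0 ≤ DD A := by
  refine Real.sSup_nonneg ?_
  rintro _ ⟨C, -, -, -, rfl⟩
  exact ENNReal.toReal_nonneg

lemma DD_le_of_reflection {A A' : Set ℝ} (hA : A ⊆ A') (hA' : volume A' ≠ ⊤) {B : ℝ}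
    (hB : ∀ t, volume.real (A' ∩ {x | t - x ∈ A'}) ≤ B) : DD A ≤ B := by
  refine Real.sSup_le ?_ (measureReal_nonneg.trans (hB 0))
  rintro _ ⟨C, hCA, -, ⟨c, hc⟩, rfl⟩
  have hsub : C ⊆ A' ∩ {x | 2 * c - x ∈ A'} := fun x hx => by
    refine ⟨hA (hCA hx), hA (hCA ?_)⟩
    have := (hc (x - c)).1 (by simpa using hx)
    rwa [show c - (x - c) = 2 * c - x by ring] at this
  exact (measureReal_mono hsub (measure_ne_top_of_subset Set.inter_subset_left hA')).trans
    (hB (2 * c))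

lemma Δ_le_of_reflection {A : Set ℝ} (hA : A ⊆ Set.Ico 0 1) (hm : MeasurableSet A) {ε B : ℝ}
    (hε : 0 ≤ ε) (hle : ε ≤ volume.real A)
    (hB : ∀ t, volume.real (A ∩ {x | t - x ∈ A}) ≤ B) : Δ ε ≤ B := by
  obtain ⟨A', hA', hm', hv⟩ := exists_measurable_subset_volume_eq hA hm hε hle
  refine le_trans (csInf_le ⟨0, ?_⟩ ⟨A', hA'.trans hA, hm', hv, rfl⟩)
    (DD_le_of_reflection hA' (measure_ne_top_of_subset hA measure_Ico_lt_top.ne) hB)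
  rintro _ ⟨_, -, -, -, rfl⟩
  exact DD_nonneg _

/-- Weights in `[0, 1]`, a discrete version of `x ↦ min 1 (b / √x)` on `(0, 1]`. -/
lemma exists_weights {b : ℝ} (hb : 0 ≤ b) (N : ℕ) :
    ∃ p : ℕ → ℝ, (∀ i, p i ∈ Set.Icc (0 : ℝ) 1) ∧ (∀ i, N ≤ i → p i = 0) ∧
      (2 * b - b ^ 2) * N - 1 ≤ ∑ i ∈ range N, p i ∧
      ∀ k, ∑ q ∈ antidiagonal k, p q.1 * p q.2 ≤ Real.pi * b ^ 2 * N := by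
  set a := b * √(Real.pi * N) with ha
  have ha0 : 0 ≤ a := by positivity
  have hw : ∀ i, 0 ≤ a * centralWeight i := fun i => mul_nonneg ha0 (centralWeight_pos i).le
  set p : ℕ → ℝ := fun i => if i < N then min 1 (a * centralWeight i) else 0 with hp
  have hp0 : ∀ i, 0 ≤ p i := fun i => by
    simp only [hp]
    split_ifs
    · exact le_min zero_le_one (hw i)
    · exact le_rfl
  have hpw : ∀ i, p i ≤ a * centralWeight i := fun i => by
    simp only [hp]
    split_ifs
    · exact min_le_right _ _
    · exact hw i
  refine ⟨p, fun i => ⟨hp0 i, ?_⟩, fun i hi => if_neg hi.not_gt, ?_, fun k => ?_⟩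
  · simp only [hp]
    split_ifs
    · exact min_le_left _ _
    · exact zero_le_one
  · have hc : 0 ≤ b * √N := by positivity
    refine le_trans ?_ ((le_sum_min_one_div_sqrt hc N).trans (sum_le_sum fun i hi => ?_))
    · have h1 : √(N : ℝ) ≤ √(N + 1) := Real.sqrt_le_sqrt (by linarith)
      have h2 : √(N : ℝ) ^ 2 = N := Real.sq_sqrt (by positivity)
      have h3 := mul_le_mul_of_nonneg_left h1 hc
      nlinarith
    · simp only [hp, if_pos (mem_range.1 hi)]
      refine min_le_min_left _ ?_
      rw [ha, Real.sqrt_mul Real.pi_pos.le, div_le_iff₀ (by positivity)]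
      have h1 : 1 ≤ √Real.pi * centralWeight i * √(i + 1) := by
        have hpos := centralWeight_pos i
        refine (one_le_sq_iff₀ (by positivity)).1 ?_
        rw [mul_pow, mul_pow, Real.sq_sqrt Real.pi_pos.le, Real.sq_sqrt (by positivity)]
        nlinarith [one_le_pi_mul_centralWeight_sq i,
          mul_pos Real.pi_pos (pow_pos hpos 2)]
      nlinarith [mul_le_mul_of_nonneg_left h1 hc]
  · calc ∑ q ∈ antidiagonal k, p q.1 * p q.2
        ≤ ∑ q ∈ antidiagonal k, a ^ 2 * (centralWeight q.1 * centralWeight q.2) := by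
          refine sum_le_sum fun q _ => ?_
          refine (mul_le_mul (hpw _) (hpw _) (hp0 _) (hw _)).trans_eq (by ring)
      _ = Real.pi * b ^ 2 * N := by
          rw [← mul_sum, sum_antidiagonal_centralWeight, ha, mul_pow,
            Real.sq_sqrt (by positivity)]
          ring

lemma Δ_le_pi_mul_sq_add {ε b δ : ℝ} (hε : 0 ≤ ε) (hb : 0 ≤ b) (hδ : 0 < δ) (hδ1 : δ ≤ 1)
    (hbε : ε + 2 * δ ≤ 2 * b - b ^ 2) : Δ ε ≤ Real.pi * b ^ 2 + 3 * δ := by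
  have hlim : Filter.Tendsto (fun N : ℕ => (2 * N + 1) * Real.exp (-(δ ^ 2 / 4 * N)))
      Filter.atTop (nhds 0) := by
    have hc : 0 < δ ^ 2 / 4 := by positivity
    have hlin : Filter.Tendsto (fun N : ℕ => δ ^ 2 / 4 * (N : ℝ)) Filter.atTop Filter.atTop :=
      tendsto_natCast_atTop_atTop.const_mul_atTop hc
    have h0 := (Real.tendsto_pow_mul_exp_neg_atTop_nhds_zero 0).comp hlin
    have h1 := (Real.tendsto_pow_mul_exp_neg_atTop_nhds_zero 1).comp hlin
    have h2 := (h1.const_mul (2 / (δ ^ 2 / 4))).add h0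
    simp only [mul_zero, add_zero] at h2
    refine h2.congr fun N => ?_
    simp only [comp_apply, pow_one, pow_zero]
    field_simp
  obtain ⟨N, hNexp, hNδ⟩ := ((hlim.eventually_lt_const zero_lt_one).and
    (Filter.eventually_ge_atTop ⌈1 / δ⌉₊)).exists
  have hNδ' : 1 ≤ δ * N := by
    have := Nat.ceil_le.1 hNδ
    rwa [div_le_iff₀' hδ] at this
  have hN : 0 < N := Nat.pos_of_ne_zero fun h => by
    rw [h] at hNδ'
    norm_num at hNδ'
  have hN' : (0 : ℝ) < N := mod_cast hN
  obtain ⟨p, hp, hp0, hpsum, hpconv⟩ := exists_weights hb N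
  obtain ⟨x, hx, hx0, hxsum, hxconv⟩ := exists_zero_one_approx hδ hδ1 hNexp hp hp0
  set S : Finset ℕ := {i ∈ range N | x i = 1} with hS
  have hmemS : ∀ i, i ∈ S ↔ x i = 1 := fun i => by
    rw [hS, mem_filter, mem_range, and_iff_right_iff_imp]
    intro h
    by_contra! hi
    rw [hx0 i hi] at h
    exact zero_ne_one h
  have hcard : (#S : ℝ) = ∑ i ∈ range N, x i := by
    rw [hS, card_filter, Nat.cast_sum]
    refine sum_congr rfl fun i _ => ?_
    rcases hx i with h | h <;> simp [h]
  refine Δ_le_of_reflection (stepSet_subset_Ico hN (filter_subset _ _))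
    (measurableSet_stepSet N S) hε ?_
    (volume_real_stepSet_inter_reflection_le hN fun k => ?_)
  · rw [volume_real_stepSet hN, le_div_iff₀ hN', hcard]
    nlinarith [mul_le_mul_of_nonneg_right hbε hN'.le]
  · have hpairs : (#{q ∈ S ×ˢ S | q.1 + q.2 = k} : ℝ)
        = ∑ q ∈ antidiagonal k, x q.1 * x q.2 := by
      have : ({q ∈ S ×ˢ S | q.1 + q.2 = k} : Finset (ℕ × ℕ))
          = {q ∈ antidiagonal k | q.1 ∈ S ∧ q.2 ∈ S} := by
        ext q
        simp only [mem_filter, mem_product, HasAntidiagonal.mem_antidiagonal]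
        tauto
      rw [this, card_filter, Nat.cast_sum]
      refine sum_congr rfl fun q _ => ?_
      simp only [hmemS]
      rcases hx q.1 with h | h <;> rcases hx q.2 with h' | h' <;> simp [h, h']
    rw [hpairs]
    linarith [hxconv k, hpconv k]

lemma Δ_le_pi_mul_sq_of_lt {ε b : ℝ} (hε : 0 ≤ ε) (hb : 0 ≤ b) (hbε : ε < 2 * b - b ^ 2) :
    Δ ε ≤ Real.pi * b ^ 2 := by
  refine le_of_forall_pos_le_add fun η hη => ?_
  set δ := min (min 1 ((2 * b - b ^ 2 - ε) / 2)) (η / 3) with hδ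
  have h1 : δ ≤ 1 := (min_le_left _ _).trans (min_le_left _ _)
  have h2 : δ ≤ (2 * b - b ^ 2 - ε) / 2 := (min_le_left _ _).trans (min_le_right _ _)
  have h3 : δ ≤ η / 3 := min_le_right _ _
  have h0 : 0 < δ := lt_min (lt_min one_pos (by linarith)) (by linarith)
  linarith [Δ_le_pi_mul_sq_add hε hb h0 h1 (by linarith)]

lemma Δ_one_le_one : Δ 1 ≤ 1 := by
  refine Δ_le_of_reflection (A := Set.Ico 0 1) subset_rfl measurableSet_Ico zero_le_one
    (by simp) fun t => ?_
  refine (measureReal_mono Set.inter_subset_left measure_Ico_lt_top.ne).trans ?_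
  simp

theorem delta_upper_pi (ε : ℝ) (hε0 : 0 < ε) (hε1 : ε ≤ 1) :
    Δ ε ≤ Real.pi * ε^2 / (1 + Real.sqrt (1 - ε))^2 := by
  set r := √(1 - ε) with hr
  have hr0 : 0 ≤ r := Real.sqrt_nonneg _
  have hr2 : r ^ 2 = 1 - ε := Real.sq_sqrt (by linarith)
  have hbound : Real.pi * ε ^ 2 / (1 + r) ^ 2 = Real.pi * (1 - r) ^ 2 := by
    rw [div_eq_iff (by positivity), show ε = (1 - r) * (1 + r) by linarith]
    ring
  rw [hbound]
  rcases hr0.eq_or_lt with h | h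
  · have : ε = 1 := by rw [← h] at hr2; linarith
    rw [this, ← h]
    linarith [Δ_one_le_one, Real.pi_gt_three]
  · have hcont : Filter.Tendsto (fun s : ℝ => Real.pi * (1 - s) ^ 2) (nhdsWithin r (Set.Iio r))
        (nhds (Real.pi * (1 - r) ^ 2)) :=
      (Continuous.tendsto (by fun_prop) r).mono_left nhdsWithin_le_nhds
    refine ge_of_tendsto hcont ?_
    filter_upwards [Ioo_mem_nhdsLT h] with s hs
    have hr1 : r ≤ 1 := by nlinarith
    exact Δ_le_pi_mul_sq_of_lt hε0.le (by linarith [hs.2]) (by nlinarith [hs.1, hs.2])
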